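/- arXiv:1707.00959 — 3 statements merged into one kernel-verified Lean document; each statement's English description precedes it below -/
import Mathlib

section
/- Let Ψ(x) := cos|x|/(4π|x|) on ℝ³∖{0}. For every f ∈ L^{6/5}(ℝ³) the convolution (Ψ*f)(x) := ∫_{ℝ³} Ψ(x−y)f(y) dy converges absolutely for almost every x ∈ ℝ³, and for every r > 0 and every exponent t with 1 ≤ t < 6 the linear operator from L^{6/5}(ℝ³) to L^t(ℝ³) given by f ↦ 1_{B_r}·(Ψ*f) is well defined, bounded, and compact (it maps bounded sets to relatively compact sets). -/
open MeasureTheory Real Metric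
open scoped ENNReal

noncomputable section

abbrev E3 := EuclideanSpace ℝ (Fin 3)

/-- The real part of the outgoing fundamental solution of the Helmholtz operator `-Δ - 1`
on `ℝ³`. -/
def Psi3 (x : E3) : ℝ :=
  Real.cos ‖x‖ / (4 * Real.pi * ‖x‖)

instance : Fact ((1 : ℝ≥0∞) ≤ 6/5) :=
  ⟨by rw [ENNReal.le_div_iff_mul_le (by norm_num) (by norm_num)]; norm_num⟩

open Filter Topology Function
open scoped NNReal

/-- A kernel bounding the absolute integrals in `L^t` defines a bounded operator `L^p → L^t`. -/
theorem exists_integralOperator {α β : Type*} [MeasurableSpace α] [MeasurableSpace β]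
    {μ : Measure α} {ν : Measure β} [SFinite ν] {p t : ℝ≥0∞} [Fact (1 ≤ p)] [Fact (1 ≤ t)]
    (ht : t ≠ ∞) {K : α → β → ℝ} (hK : StronglyMeasurable (uncurry K)) {C : ℝ≥0}
    (hC : ∀ f : Lp ℝ p ν, eLpNorm (fun x => ∫⁻ y, ‖K x y * f y‖ₑ ∂ν) t μ ≤ C * ‖f‖ₑ) :
    (∀ f : Lp ℝ p ν, ∀ᵐ x ∂μ, Integrable (fun y => K x y * f y) ν) ∧
      ∃ N : Lp ℝ p ν →L[ℝ] Lp ℝ t μ, ‖N‖ ≤ C ∧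
        ∀ f : Lp ℝ p ν, N f =ᵐ[μ] fun x => ∫ y, K x y * f y ∂ν := by
  have hKf : ∀ f : Lp ℝ p ν, StronglyMeasurable (uncurry fun x y => K x y * f y) := fun f =>
    hK.mul ((Lp.stronglyMeasurable f).comp_measurable measurable_snd)
  have hint : ∀ f : Lp ℝ p ν, ∀ᵐ x ∂μ, Integrable (fun y => K x y * f y) ν := by
    intro f
    have hlt := lintegral_rpow_enorm_lt_top_of_eLpNorm_lt_top
      (zero_lt_one.trans_le Fact.out).ne' ht ((hC f).trans_lt (by finiteness))
    have hm : Measurable fun x => ∫⁻ y, ‖K x y * f y‖ₑ ∂ν :=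
      (hKf f).enorm.lintegral_prod_right'
    filter_upwards [ae_lt_top (by fun_prop) hlt.ne] with x hx
    refine ⟨(hKf f).of_uncurry_left.aestronglyMeasurable, ?_⟩
    have h0 : 0 < t.toReal := ENNReal.toReal_pos (zero_lt_one.trans_le Fact.out).ne' ht
    rw [enorm_eq_self, ENNReal.rpow_lt_top_iff_of_pos h0] at hx
    exact hx
  have hbound : ∀ f : Lp ℝ p ν, eLpNorm (fun x => ∫ y, K x y * f y ∂ν) t μ ≤ C * ‖f‖ₑ :=
    fun f => (eLpNorm_mono_enorm fun x =>
      (enorm_integral_le_lintegral_enorm _).trans_eq (enorm_eq_self _).symm).trans (hC f)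
  have hmem : ∀ f : Lp ℝ p ν, MemLp (fun x => ∫ y, K x y * f y ∂ν) t μ := fun f =>
    ⟨(hKf f).integral_prod_right.aestronglyMeasurable, (hbound f).trans_lt (by finiteness)⟩
  let N : Lp ℝ p ν →ₗ[ℝ] Lp ℝ t μ :=
    { toFun := fun f => (hmem f).toLp
      map_add' := fun f g => by
        rw [← MemLp.toLp_add, MemLp.toLp_eq_toLp_iff]
        filter_upwards [hint f, hint g] with x hf hg
        rw [Pi.add_apply, ← integral_add hf hg]
        refine integral_congr_ae ?_
        filter_upwards [Lp.coeFn_add f g] with y hy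
        rw [hy, Pi.add_apply, mul_add]
      map_smul' := fun c f => by
        rw [RingHom.id_apply, ← MemLp.toLp_const_smul, MemLp.toLp_eq_toLp_iff]
        refine Eventually.of_forall fun x => ?_
        simp only [Pi.smul_apply]
        rw [← integral_smul]
        refine integral_congr_ae ?_
        filter_upwards [Lp.coeFn_smul c f] with y hy
        rw [hy, Pi.smul_apply, smul_eq_mul, smul_eq_mul]
        ring }
  refine ⟨hint, N.mkContinuous C fun f => ?_, N.mkContinuous_norm_le C.2 _,
    fun f => (hmem f).coeFn_toLp⟩
  have h := ENNReal.toReal_mono (by finiteness) (hbound f)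
  simpa [N, Lp.norm_toLp] using h

/-- **Young's convolution inequality**. -/
theorem lintegral_convolution_rpow_le {G : Type*} [NormedAddCommGroup G] [MeasurableSpace G]
    [BorelSpace G] [SecondCountableTopology G] {μ : Measure G} [SFinite μ]
    [μ.IsAddLeftInvariant] [μ.IsNegInvariant] {h f : G → ℝ≥0∞} (hh : Measurable h) (hf : Measurable f)
    {p q s : ℝ} (hp : 0 < p) (hq : 0 < q) (hps : p ≤ s) (hqs : q ≤ s)
    (hpq : 1 / p + 1 / q = 1 + 1 / s) :
    ∫⁻ x, (∫⁻ y, h (x - y) * f y ∂μ) ^ s ∂μ ≤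
      (∫⁻ x, h x ^ q ∂μ) ^ (s / q) * (∫⁻ x, f x ^ p ∂μ) ^ (s / p) := by
  have hs : 0 < s := hp.trans_le hps
  set H := ∫⁻ x, h x ^ q ∂μ
  set F := ∫⁻ x, f x ^ p ∂μ
  have hH : ∀ x, ∫⁻ y, h (x - y) ^ q ∂μ = H := fun x =>
    lintegral_sub_left_eq_self (fun y => h y ^ q) x
  have ha : 0 ≤ 1 / q - 1 / s := sub_nonneg.2 (one_div_le_one_div_of_le hq hqs)
  have hb : 0 ≤ 1 / p - 1 / s := sub_nonneg.2 (one_div_le_one_div_of_le hp hps)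
  have holder : ∀ x, ∫⁻ y, h (x - y) * f y ∂μ ≤
      (∫⁻ y, h (x - y) ^ q * f y ^ p ∂μ) ^ (1 / s) * (H ^ (1 / q - 1 / s) * F ^ (1 / p - 1 / s)) := by
    intro x
    have := ENNReal.lintegral_prod_norm_pow_le (μ := μ) Finset.univ
      (f := ![fun y => h (x - y) ^ q * f y ^ p, fun y => h (x - y) ^ q, fun y => f y ^ p])
      (p := ![1 / s, 1 / q - 1 / s, 1 / p - 1 / s])
      (by
        intro i _
        fin_cases i
        · exact (by fun_prop : Measurable fun y => h (x - y) ^ q * f y ^ p).aemeasurable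
        · exact (by fun_prop : Measurable fun y => h (x - y) ^ q).aemeasurable
        · exact (by fun_prop : Measurable fun y => f y ^ p).aemeasurable)
      (by simp [Fin.sum_univ_three] at hpq ⊢; linarith)
      (by
        intro i _
        fin_cases i
        · simp [hs.le]
        · exact ha
        · exact hb)
    simp only [Fin.prod_univ_three, Matrix.cons_val_zero, Matrix.cons_val_one, Matrix.cons_val,
      hH] at this
    rw [← mul_assoc]
    refine le_trans (le_of_eq (lintegral_congr fun y => ?_)) this
    rw [ENNReal.mul_rpow_of_nonneg _ _ (by positivity), ← ENNReal.rpow_mul, ← ENNReal.rpow_mul,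
      ← ENNReal.rpow_mul, ← ENNReal.rpow_mul, mul_assoc (_ * _), mul_mul_mul_comm,
      ← ENNReal.rpow_add_of_nonneg _ _ (by positivity) (by positivity), ← ENNReal.rpow_add_of_nonneg _ _
        (by positivity) (by positivity), ← mul_add, ← mul_add, add_sub_cancel, add_sub_cancel,
      mul_one_div_cancel hq.ne', mul_one_div_cancel hp.ne', ENNReal.rpow_one, ENNReal.rpow_one]
  calc
    _ ≤ ∫⁻ x, (∫⁻ y, h (x - y) ^ q * f y ^ p ∂μ) *
          (H ^ (s / q - 1) * F ^ (s / p - 1)) ∂μ := by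
      refine lintegral_mono fun x => (ENNReal.rpow_le_rpow (holder x) hs.le).trans_eq ?_
      rw [ENNReal.mul_rpow_of_nonneg _ _ hs.le, ENNReal.mul_rpow_of_nonneg _ _ hs.le,
        ← ENNReal.rpow_mul, ← ENNReal.rpow_mul, ← ENNReal.rpow_mul, one_div_mul_cancel hs.ne',
        ENNReal.rpow_one]
      congr 3 <;> field_simp
    _ = (H * F) * (H ^ (s / q - 1) * F ^ (s / p - 1)) := by
      have hm : Measurable fun z : G × G => h (z.1 - z.2) ^ q * f z.2 ^ p := by fun_prop
      rw [lintegral_mul_const _ hm.lintegral_prod_right', lintegral_lintegral_swap (by fun_prop)]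
      congr 1
      have hy : ∀ y, ∫⁻ x, h (x - y) ^ q * f y ^ p ∂μ = H * f y ^ p := fun y => by
        rw [lintegral_mul_const _ (by fun_prop), lintegral_sub_right_eq_self (fun y => h y ^ q)]
      simp_rw [hy]
      rw [lintegral_const_mul _ (by fun_prop)]
    _ = H ^ (s / q) * F ^ (s / p) := by
      have e : ∀ (A : ℝ≥0∞) {u : ℝ}, 0 < u → u ≤ s → A ^ (s / u) = A * A ^ (s / u - 1) := by
        intro A u hu hus
        have h1 : 0 ≤ s / u - 1 := sub_nonneg.2 ((one_le_div hu).2 hus)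
        conv_rhs => enter [1]; rw [← ENNReal.rpow_one A]
        rw [← ENNReal.rpow_add_of_nonneg _ _ zero_le_one h1, add_sub_cancel]
      rw [e H hq hqs, e F hp hps]
      ring

open ContinuousLinearMap in
/-- For `Φ ∈ L^t(μ; E)` and a bounded bilinear form `B`, the operator `g ↦ B g ∘ Φ` is compact. -/
theorem isCompactOperator_compLpL₂_flip {α G E : Type*} [MeasurableSpace α] {μ : Measure α}
    [NormedAddCommGroup G] [NormedSpace ℝ G] [NormedAddCommGroup E] [NormedSpace ℝ E]
    {t : ℝ≥0∞} [Fact (1 ≤ t)] (ht : t ≠ ∞) (B : G →L[ℝ] E →L[ℝ] ℝ) (Φ : Lp E t μ) :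
    IsCompactOperator ((B.compLpL₂ t μ).flip Φ) := by
  induction Φ using Lp.induction ht with
  | @indicatorConst c s hs hμs =>
    have key : ((B.compLpL₂ t μ).flip (indicatorConstLp t hs hμs.ne c) : G → Lp ℝ t μ) =
        (toSpanSingleton ℝ (indicatorConstLp t hs hμs.ne (1 : ℝ))) ∘ id ∘ (B.flip c) := by
      ext1 g
      apply Lp.ext
      simp only [flip_apply, comp_apply, id, toSpanSingleton_apply, compLpL₂_apply_apply]
      filter_upwards [coeFn_compLp (B g) (indicatorConstLp t hs hμs.ne c),
        Lp.coeFn_smul (B g c) (indicatorConstLp t hs hμs.ne (1 : ℝ)),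
        indicatorConstLp_coeFn (p := t) (hs := hs) (hμs := hμs.ne) (c := c),
        indicatorConstLp_coeFn (p := t) (hs := hs) (hμs := hμs.ne) (c := (1 : ℝ))]
        with x h1 h2 h3 h4
      rw [h1, h2, Pi.smul_apply, h3, h4]
      by_cases hx : x ∈ s <;> simp [hx]
    rw [Lp.simpleFunc.coe_indicatorConst, key]
    exact (isCompactOperator_id.comp_clm (B.flip c)).clm_comp _
  | add hf hg _ h1 h2 =>
    rw [map_add]
    exact h1.add h2
  | isClosed =>
    exact (isClosed_setOfPred_isCompactOperator (𝕜₁ := ℝ) (𝕜₂ := ℝ) (σ₁₂ := RingHom.id ℝ)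
      (M₁ := G) (M₂ := Lp ℝ t μ)).preimage (B.compLpL₂ t μ).flip.continuous

theorem Psi3_neg (x : E3) : Psi3 (-x) = Psi3 x := by
  simp [Psi3]

theorem measurable_Psi3 : Measurable Psi3 := by
  unfold Psi3
  fun_prop

theorem norm_Psi3_le (x : E3) : ‖Psi3 x‖ ≤ ‖x‖⁻¹ := by
  rcases (norm_nonneg x).eq_or_lt with hx | hx
  · simp [Psi3, ← hx]
  have h1 : 1 ≤ 4 * π := by linarith [pi_gt_three]
  rw [Psi3, norm_div, norm_of_nonneg (by positivity : 0 ≤ 4 * π * ‖x‖), ← one_div]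
  exact div_le_div₀ zero_le_one (abs_cos_le_one _) hx (le_mul_of_one_le_left hx.le h1)

theorem tendsto_setLIntegral_ball_Psi3_rpow {q : ℝ} (hq0 : 0 ≤ q) (hq : q < 3) :
    Tendsto (fun ε => ∫⁻ x in ball (0 : E3) ε, ‖Psi3 x‖ₑ ^ q) (𝓝[>] 0) (𝓝 0) := by
  have hint : IntegrableOn (fun x : E3 => ‖x‖ ^ (-q)) (ball 0 1) := by
    rw [integrableOn_fun_norm_addHaar volume (f := fun y => y ^ (-q)), finrank_euclideanSpace_fin]
    refine ((intervalIntegral.integrableOn_Ioo_rpow_iff (s := 2 - q) one_pos).2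
      (by linarith)).congr_fun (fun y hy => ?_) measurableSet_Ioo
    simp only [sub_eq_add_neg, rpow_add hy.1]
    norm_num
  have hfin : ∫⁻ x in ball (0 : E3) 1, ‖Psi3 x‖ₑ ^ q ≠ ∞ := by
    refine (lt_of_le_of_lt (lintegral_mono fun x => ?_) hint.2).ne
    rw [← ofReal_norm, ENNReal.ofReal_rpow_of_nonneg (norm_nonneg _) hq0, ← ofReal_norm,
      norm_of_nonneg (by positivity : 0 ≤ ‖x‖ ^ (-q)), rpow_neg (norm_nonneg _),
      ← inv_rpow (norm_nonneg _)]
    exact ENNReal.ofReal_le_ofReal (rpow_le_rpow (norm_nonneg _) (norm_Psi3_le x) hq0)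
  have hvol : Tendsto (fun ε => volume.restrict (ball (0 : E3) 1) (ball 0 ε)) (𝓝[>] 0) (𝓝 0) := by
    refine tendsto_of_tendsto_of_tendsto_of_le_of_le tendsto_const_nhds ?_ (fun _ => zero_le)
      (fun _ => Measure.restrict_apply_le _ _)
    simp_rw [EuclideanSpace.volume_ball_fin_three]
    have : Continuous fun ε : ℝ => ENNReal.ofReal ε ^ 3 * ENNReal.ofReal (π * 4 / 3) := by
      have := ENNReal.continuous_mul_const (a := ENNReal.ofReal (π * 4 / 3)) (by finiteness)
      exact this.comp ((ENNReal.continuous_pow 3).comp ENNReal.continuous_ofReal)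
    simpa using (this.tendsto 0).mono_left nhdsWithin_le_nhds
  refine (tendsto_setLIntegral_zero hfin hvol).congr' ?_
  filter_upwards [Ioo_mem_nhdsGT one_pos] with ε hε
  rw [Measure.restrict_restrict measurableSet_ball,
    Set.inter_eq_left.2 (ball_subset_ball hε.2.le)]

theorem memLp_indicator_compl_ball_Psi3 {ε : ℝ} (hε : 0 < ε) :
    MemLp ((ball (0 : E3) ε)ᶜ.indicator Psi3) 6 := by
  have hg : MemLp (fun x : E3 => (1 + ‖x‖) ^ (-1 : ℝ)) 6 := by
    rw [← integrable_norm_rpow_iff (Measurable.aestronglyMeasurable (by fun_prop)) (by norm_num) (by norm_num)]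
    refine (integrable_one_add_norm (E := E3) (r := 6) (by simp; norm_num)).congr
      (Eventually.of_forall fun x => ?_)
    have h0 : 0 < 1 + ‖x‖ := by positivity
    simp only [norm_of_nonneg (rpow_nonneg h0.le _), ← rpow_mul h0.le]
    norm_num
  refine hg.of_le_mul (c := 1 / ε + 1)
    (measurable_Psi3.indicator measurableSet_ball.compl).aestronglyMeasurable
    (Eventually.of_forall fun x => ?_)
  have h0 : 0 < 1 + ‖x‖ := by positivity
  rw [norm_of_nonneg (rpow_nonneg h0.le _), rpow_neg_one]
  by_cases hx : x ∈ (ball (0 : E3) ε)ᶜ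
  · rw [Set.indicator_of_mem hx]
    refine (norm_Psi3_le x).trans ?_
    have hx' : ε ≤ ‖x‖ := by simpa using hx
    have hx0 : 0 < ‖x‖ := hε.trans_le hx'
    rw [← div_eq_mul_inv, le_div_iff₀ h0, mul_add, mul_one, inv_mul_cancel₀ hx0.ne',
      one_div]
    gcongr
  · rw [Set.indicator_of_notMem hx, norm_zero]
    positivity

instance : ENNReal.HolderConjugate (6 / 5) 6 := by
  rw [ENNReal.holderConjugate_iff, ENNReal.inv_div (by norm_num) (by norm_num), ← one_div,
    ENNReal.div_add_div_same]
  norm_num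
  exact ENNReal.div_self (by norm_num) (by norm_num)

instance : Fact ((6 : ℝ≥0∞) ≠ ∞) := ⟨by norm_num⟩

instance : Fact ((1 : ℝ≥0∞) ≤ 6) := ⟨by norm_num⟩

/-- Integral operators whose kernel `k (y - x)` comes from a function `k ∈ L⁶`. -/
theorem exists_isCompactOperator_of_memLp {k : E3 → ℝ} (hk : MemLp k 6) (r : ℝ) {t : ℝ≥0∞}
    [Fact (1 ≤ t)] (ht : t ≠ ∞) :
    ∃ F : Lp ℝ (6/5 : ℝ≥0∞) (volume : Measure E3) →L[ℝ] Lp ℝ t (volume : Measure E3),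
      IsCompactOperator F ∧ ∀ f, (F f : E3 → ℝ) =ᵐ[volume]
        (ball (0 : E3) r).indicator (fun x => ∫ y, k (y - x) * (f : E3 → ℝ) y) := by
  let κ : Lp ℝ 6 (volume : Measure E3) := hk.toLp k
  let τ : E3 → Lp ℝ 6 (volume : Measure E3) := fun x => DomAddAct.mk (-x) +ᵥ κ
  have hτc : Continuous τ := by
    have : Continuous fun x : E3 => DomAddAct.mk (-x) :=
      DomAddAct.mkHomeomorph.continuous.comp continuous_neg
    exact this.vadd continuous_const
  have hτ : ∀ x, τ x =ᵐ[volume] fun y => k (y - x) := by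
    intro x
    have hqmp := (measurePreserving_vadd (-x) (volume : Measure E3)).quasiMeasurePreserving
    filter_upwards [DomAddAct.vadd_Lp_ae_eq (DomAddAct.mk (-x)) κ,
      hqmp.ae_eq_comp hk.coeFn_toLp] with y h1 h2
    rw [h1, Equiv.symm_apply_apply]
    exact h2.trans (by simp [sub_eq_neg_add])
  have hΦ : MemLp ((ball (0 : E3) r).indicator τ) t := by
    rw [memLp_indicator_iff_restrict measurableSet_ball]
    have : IsFiniteMeasure (volume.restrict (ball (0 : E3) r)) :=
      isFiniteMeasure_restrict.2 measure_ball_lt_top.ne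
    exact MemLp.of_bound hτc.aestronglyMeasurable ‖κ‖
      (Eventually.of_forall fun x => (DomAddAct.norm_vadd_Lp _ _).le)
  let B := (ContinuousLinearMap.mul ℝ ℝ).lpPairing (volume : Measure E3) (6 / 5) 6
  refine ⟨_, isCompactOperator_compLpL₂_flip ht B hΦ.toLp, fun f => ?_⟩
  filter_upwards [(B f).coeFn_compLp hΦ.toLp, hΦ.coeFn_toLp] with x h1 h2
  rw [ContinuousLinearMap.flip_apply, ContinuousLinearMap.compLpL₂_apply_apply, h1, h2]
  by_cases hx : x ∈ ball (0 : E3) r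
  · rw [Set.indicator_of_mem hx, Set.indicator_of_mem hx,
      ContinuousLinearMap.lpPairing_eq_integral]
    refine integral_congr_ae ?_
    filter_upwards [hτ x] with y hy
    rw [hy, ContinuousLinearMap.mul_apply', mul_comm]
  · rw [Set.indicator_of_notMem hx, Set.indicator_of_notMem hx, map_zero]

/-- The part of `Ψ` near the origin contributes an operator of arbitrarily small norm. -/
theorem exists_integralOperator_norm_le (r : ℝ) {t : ℝ} (ht1 : 1 ≤ t) (ht6 : t < 6)
    [Fact ((1 : ℝ≥0∞) ≤ ENNReal.ofReal t)] {δ : ℝ≥0} (hδ : 0 < δ) :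
    ∃ ε : ℝ, 0 < ε ∧
      (∀ f : Lp ℝ (6/5 : ℝ≥0∞) (volume : Measure E3), ∀ᵐ x : E3, x ∈ ball (0 : E3) r →
        Integrable (fun y => (ball 0 ε).indicator Psi3 (x - y) * (f : E3 → ℝ) y)) ∧
      ∃ N : Lp ℝ (6/5 : ℝ≥0∞) (volume : Measure E3) →L[ℝ]
          Lp ℝ (ENNReal.ofReal t) (volume : Measure E3),
        ‖N‖ ≤ δ ∧ ∀ f, (N f : E3 → ℝ) =ᵐ[volume] (ball (0 : E3) r).indicator
          (fun x => ∫ y, (ball 0 ε).indicator Psi3 (x - y) * (f : E3 → ℝ) y) := by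
  obtain ⟨s, hs3, hts, hs6⟩ : ∃ s : ℝ, 3 ≤ s ∧ t ≤ s ∧ s < 6 :=
    ⟨max t 3, le_max_right _ _, le_max_left _ _, max_lt ht6 (by norm_num)⟩
  have hs0 : 0 < s := by linarith
  obtain ⟨q, hq⟩ : ∃ q, q = 6 * s / (s + 6) := ⟨_, rfl⟩
  have hq0 : 0 < q := by rw [hq]; positivity
  have hq3 : q < 3 := by rw [hq, div_lt_iff₀ (by positivity)]; linarith
  have hqs : q ≤ s := by rw [hq, div_le_iff₀ (by positivity)]; nlinarith
  have hpq : 1 / (6 / 5) + 1 / q = 1 + 1 / s := by rw [hq]; field_simp; ring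
  have htr : 0 ≤ 1 / t - 1 / s := sub_nonneg.2 (one_div_le_one_div_of_le (by linarith) hts)
  set M : ℝ≥0∞ := volume (ball (0 : E3) r) ^ (1 / t - 1 / s)
  have hM : M ≠ ∞ := ENNReal.rpow_ne_top_of_nonneg htr measure_ball_lt_top.ne
  have hlim : Tendsto (fun ε => M * (∫⁻ x in ball (0 : E3) ε, ‖Psi3 x‖ₑ ^ q) ^ (1 / q))
      (𝓝[>] 0) (𝓝 0) := by
    have h1 := (ENNReal.continuous_rpow_const (y := 1 / q)).tendsto 0 |>.comp
      (tendsto_setLIntegral_ball_Psi3_rpow hq0.le hq3)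
    rw [ENNReal.zero_rpow_of_pos (by positivity)] at h1
    simpa using ENNReal.Tendsto.const_mul h1 (Or.inr hM)
  obtain ⟨ε, hε, hε0⟩ := ((hlim.eventually_le_const (u := (δ : ℝ≥0∞)) (by simpa using hδ)).and
    self_mem_nhdsWithin).exists
  refine ⟨ε, hε0, ?_⟩
  set h : E3 → ℝ := (ball 0 ε).indicator Psi3 with hdef
  have hh : Measurable h := measurable_Psi3.indicator measurableSet_ball
  have hH : ∫⁻ x, ‖h x‖ₑ ^ q = ∫⁻ x in ball (0 : E3) ε, ‖Psi3 x‖ₑ ^ q := by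
    rw [← lintegral_indicator measurableSet_ball]
    refine lintegral_congr fun x => ?_
    by_cases hx : x ∈ ball (0 : E3) ε <;> simp [hdef, hx, hq0]
  let K : E3 → E3 → ℝ := fun x y => (ball (0 : E3) r).indicator (fun x => h (x - y)) x
  have hK : StronglyMeasurable (uncurry K) := by
    have : uncurry K = (Prod.fst ⁻¹' ball (0 : E3) r).indicator fun z => h (z.1 - z.2) := rfl
    rw [this]
    exact (Measurable.indicator (by fun_prop)
      (measurable_fst measurableSet_ball)).stronglyMeasurable
  have hKx : ∀ {x} y, x ∈ ball (0 : E3) r → K x y = h (x - y) := fun y hx =>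
    Set.indicator_of_mem hx _
  have hKx' : ∀ {x} y, x ∉ ball (0 : E3) r → K x y = 0 := fun y hx =>
    Set.indicator_of_notMem hx _
  have hbound : ∀ f : Lp ℝ (6/5 : ℝ≥0∞) (volume : Measure E3),
      eLpNorm (fun x => ∫⁻ y, ‖K x y * f y‖ₑ) (ENNReal.ofReal t) volume ≤ δ * ‖f‖ₑ := by
    intro f
    have hf : Measurable f := (Lp.stronglyMeasurable f).measurable
    let g : E3 → ℝ≥0∞ := fun x => ∫⁻ y, ‖h (x - y)‖ₑ * ‖f y‖ₑ
    have hg : Measurable g := Measurable.lintegral_prod_right' (f := fun z : E3 × E3 =>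
      ‖h (z.1 - z.2)‖ₑ * ‖f z.2‖ₑ) (by fun_prop)
    have hgK : (fun x => ∫⁻ y, ‖K x y * f y‖ₑ) = (ball (0 : E3) r).indicator g := by
      funext x
      by_cases hx : x ∈ ball (0 : E3) r
      · simp [hx, hKx, g]
      · simp [hx, hKx']
    have hyoung := lintegral_convolution_rpow_le (μ := (volume : Measure E3)) hh.enorm hf.enorm
      (by norm_num : (0 : ℝ) < 6 / 5) hq0 (by linarith) hqs hpq
    have hgs : eLpNorm g (ENNReal.ofReal s) volume ≤ (∫⁻ x, ‖h x‖ₑ ^ q) ^ (1 / q) * ‖f‖ₑ := by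
      rw [Lp.enorm_def, eLpNorm_eq_lintegral_rpow_enorm_toReal (by simpa) (by simp),
        eLpNorm_eq_lintegral_rpow_enorm_toReal (by simp) (by finiteness),
        ENNReal.toReal_ofReal hs0.le, ENNReal.toReal_div]
      simp only [enorm_eq_self, ENNReal.toReal_ofNat]
      refine (ENNReal.rpow_le_rpow hyoung (by positivity)).trans_eq ?_
      rw [ENNReal.mul_rpow_of_nonneg _ _ (by positivity), ← ENNReal.rpow_mul, ← ENNReal.rpow_mul]
      congr 2 <;> field_simp
    calc
      _ = eLpNorm g (ENNReal.ofReal t) (volume.restrict (ball (0 : E3) r)) := by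
        rw [hgK, eLpNorm_indicator_eq_eLpNorm_restrict measurableSet_ball]
      _ ≤ eLpNorm g (ENNReal.ofReal s) (volume.restrict (ball (0 : E3) r)) * M := by
        refine (eLpNorm_le_eLpNorm_mul_rpow_measure_univ (ENNReal.ofReal_le_ofReal hts)
          hg.aestronglyMeasurable).trans_eq ?_
        rw [Measure.restrict_apply_univ, ENNReal.toReal_ofReal (by linarith),
          ENNReal.toReal_ofReal hs0.le]
      _ ≤ (∫⁻ x, ‖h x‖ₑ ^ q) ^ (1 / q) * ‖f‖ₑ * M := by
        gcongr
        exact (eLpNorm_mono_measure _ Measure.restrict_le_self).trans hgs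
      _ = M * (∫⁻ x in ball (0 : E3) ε, ‖Psi3 x‖ₑ ^ q) ^ (1 / q) * ‖f‖ₑ := by
        rw [hH]; ring
      _ ≤ δ * ‖f‖ₑ := by gcongr
  obtain ⟨hint, N, hN, hNf⟩ := exists_integralOperator (by simp) hK hbound
  refine ⟨fun f => ?_, N, hN, fun f => ?_⟩
  · filter_upwards [hint f] with x hx hxr
    simpa only [hKx _ hxr] using hx
  · filter_upwards [hNf f] with x hx
    rw [hx]
    by_cases hxr : x ∈ ball (0 : E3) r
    · simp only [hKx _ hxr, Set.indicator_of_mem hxr]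
    · simp only [hKx' _ hxr, Set.indicator_of_notMem hxr, zero_mul, integral_zero]

theorem integrable_indicator_compl_ball_Psi3_mul {ε : ℝ} (hε : 0 < ε) (x : E3)
    (f : Lp ℝ (6/5 : ℝ≥0∞) (volume : Measure E3)) :
    Integrable fun y => (ball (0 : E3) ε)ᶜ.indicator Psi3 (x - y) * (f : E3 → ℝ) y :=
  ((memLp_indicator_compl_ball_Psi3 hε).comp_measurePreserving
    (Measure.measurePreserving_sub_left volume x)).integrable_mul (Lp.memLp f)

theorem Psi3_eq_indicator_add (ε : ℝ) (x : E3) :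
    Psi3 x = (ball (0 : E3) ε).indicator Psi3 x + (ball (0 : E3) ε)ᶜ.indicator Psi3 x := by
  rw [← Pi.add_apply, Set.indicator_self_add_compl]

theorem indicator_compl_ball_Psi3_sub_comm (ε : ℝ) (x y : E3) :
    (ball (0 : E3) ε)ᶜ.indicator Psi3 (y - x) = (ball (0 : E3) ε)ᶜ.indicator Psi3 (x - y) := by
  simp only [Set.indicator, Set.mem_compl_iff, mem_ball_zero_iff,
    ← neg_sub x y, Psi3_neg, norm_neg]

theorem ae_integrable_Psi3_mul (f : Lp ℝ (6/5 : ℝ≥0∞) (volume : Measure E3)) :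
    ∀ᵐ x : E3, Integrable (fun y => Psi3 (x - y) * (f : E3 → ℝ) y) := by
  have : Fact ((1 : ℝ≥0∞) ≤ ENNReal.ofReal 1) := ⟨by simp⟩
  have hball : ∀ n : ℕ, ∀ᵐ x : E3, x ∈ ball (0 : E3) n →
      Integrable (fun y => Psi3 (x - y) * (f : E3 → ℝ) y) := by
    intro n
    obtain ⟨ε, hε, hint, -⟩ :=
      exists_integralOperator_norm_le n le_rfl (by norm_num : (1 : ℝ) < 6) one_pos
    filter_upwards [hint f] with x hx hxn
    simp only [Psi3_eq_indicator_add ε (x - _), add_mul]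
    exact (hx hxn).add (integrable_indicator_compl_ball_Psi3_mul hε x f)
  filter_upwards [ae_all_iff.2 hball] with x hx
  obtain ⟨n, hn⟩ := exists_nat_gt ‖x‖
  exact hx n (by simpa using hn)

theorem exists_isCompactOperator_Psi3 (r : ℝ) {t : ℝ} (ht1 : 1 ≤ t) (ht6 : t < 6)
    [Fact ((1 : ℝ≥0∞) ≤ ENNReal.ofReal t)] :
    ∃ T : Lp ℝ (6/5 : ℝ≥0∞) (volume : Measure E3) →L[ℝ]
          Lp ℝ (ENNReal.ofReal t) (volume : Measure E3),
      IsCompactOperator T ∧ ∀ f, (T f : E3 → ℝ) =ᵐ[volume]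
        (ball (0 : E3) r).indicator (fun x => ∫ y, Psi3 (x - y) * (f : E3 → ℝ) y) := by
  have key : ∀ δ : ℝ≥0, 0 < δ → ∃ N F : Lp ℝ (6/5 : ℝ≥0∞) (volume : Measure E3) →L[ℝ]
      Lp ℝ (ENNReal.ofReal t) (volume : Measure E3), ‖N‖ ≤ δ ∧ IsCompactOperator F ∧
      ∀ f, ((N + F) f : E3 → ℝ) =ᵐ[volume]
        (ball (0 : E3) r).indicator (fun x => ∫ y, Psi3 (x - y) * (f : E3 → ℝ) y) := by
    intro δ hδ
    obtain ⟨ε, hε, hint, N, hN, hNf⟩ := exists_integralOperator_norm_le r ht1 ht6 hδ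
    obtain ⟨F, hF, hFf⟩ := exists_isCompactOperator_of_memLp
      (memLp_indicator_compl_ball_Psi3 hε) r (t := ENNReal.ofReal t) (by simp)
    refine ⟨N, F, hN, hF, fun f => ?_⟩
    filter_upwards [Lp.coeFn_add (N f) (F f), hNf f, hFf f, hint f] with x h1 h2 h3 h4
    rw [add_apply, h1, Pi.add_apply, h2, h3]
    by_cases hx : x ∈ ball (0 : E3) r
    · simp only [Set.indicator_of_mem hx, indicator_compl_ball_Psi3_sub_comm,
        Psi3_eq_indicator_add ε (x - _), add_mul]
      exact (integral_add (h4 hx) (integrable_indicator_compl_ball_Psi3_mul hε x f)).symm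
    · simp [hx]
  obtain ⟨N, F, -, -, hT⟩ := key 1 one_pos
  refine ⟨N + F, ?_, hT⟩
  refine isClosed_setOfPred_isCompactOperator.closure_subset
    (Metric.mem_closure_iff.2 fun δ hδ => ?_)
  obtain ⟨N', F', hN', hF', hT'⟩ := key ⟨δ / 2, (half_pos hδ).le⟩ (half_pos hδ)
  refine ⟨F', hF', ?_⟩
  have heq : N + F = N' + F' := by
    ext1 f
    exact Lp.ext ((hT f).trans (hT' f).symm)
  rw [heq, dist_eq_norm, add_sub_cancel_right]
  exact hN'.trans_lt (half_lt_self hδ)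

/-- Lemma 2.2, three-dimensional case: for `f ∈ L^{6/5}(ℝ³)` the convolution `Ψ * f`
converges absolutely a.e., and for every `r > 0` and `1 ≤ t < 6` the operator
`f ↦ 1_{B_r}·(Ψ * f)` is a well-defined, bounded and compact linear operator from
`L^{6/5}(ℝ³)` to `L^t(ℝ³)`. -/
theorem stmt4 :
    (∀ f : Lp ℝ (6/5 : ℝ≥0∞) (volume : Measure E3),
      ∀ᵐ x : E3, Integrable (fun y => Psi3 (x - y) * (f : E3 → ℝ) y)) ∧
    (∀ r : ℝ, 0 < r → ∀ t : ℝ, ∀ ht : 1 ≤ t, t < 6 →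
      haveI : Fact ((1 : ℝ≥0∞) ≤ ENNReal.ofReal t) :=
        ⟨ENNReal.ofReal_one ▸ ENNReal.ofReal_le_ofReal ht⟩
      ∃ T : Lp ℝ (6/5 : ℝ≥0∞) (volume : Measure E3) →L[ℝ]
            Lp ℝ (ENNReal.ofReal t) (volume : Measure E3),
        IsCompactOperator T ∧
        ∀ f, (T f : E3 → ℝ) =ᵐ[volume]
          (ball (0 : E3) r).indicator
            (fun x => ∫ y, Psi3 (x - y) * (f : E3 → ℝ) y)) := by
  refine ⟨ae_integrable_Psi3_mul, fun r _ t ht1 ht6 => ?_⟩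
  have : Fact ((1 : ℝ≥0∞) ≤ ENNReal.ofReal t) :=
    ⟨ENNReal.ofReal_one ▸ ENNReal.ofReal_le_ofReal ht1⟩
  exact exists_isCompactOperator_Psi3 r ht1 ht6

end
end

section
/- Let Ψ(x) := (cos|x| + |x|·sin|x|)/(8π²|x|³) on ℝ⁵∖{0}. For every f ∈ L^{10/7}(ℝ⁵) the convolution (Ψ*f)(x) := ∫_{ℝ⁵} Ψ(x−y)f(y) dy converges absolutely for almost every x ∈ ℝ⁵, and for every r > 0 and every exponent t with 1 ≤ t < 10/3 the linear operator from L^{10/7}(ℝ⁵) to L^t(ℝ⁵) given by f ↦ 1_{B_r}·(Ψ*f) is well defined, bounded, and compact (it maps bounded sets to relatively compact sets). -/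
open MeasureTheory Real Metric
open scoped ENNReal

noncomputable section

abbrev E5 := EuclideanSpace ℝ (Fin 5)

/-- The real part of the outgoing fundamental solution of the Helmholtz operator `-Δ - 1`
on `ℝ⁵`. -/
def Psi5 (x : E5) : ℝ :=
  (Real.cos ‖x‖ + ‖x‖ * Real.sin ‖x‖) / (8 * Real.pi ^ 2 * ‖x‖ ^ 3)

instance : Fact ((1 : ℝ≥0∞) ≤ 10/7) :=
  ⟨by rw [ENNReal.le_div_iff_mul_le (by norm_num) (by norm_num)]; norm_num⟩

section Young

variable {G : Type*} [AddCommGroup G] [MeasurableSpace G] [MeasurableAdd₂ G] [MeasurableNeg G]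
  {μ : Measure G} [SFinite μ]

theorem measurable_integral_sub_mul {k f : G → ℝ} (hk : Measurable k) (hf : Measurable f) :
    Measurable fun x => ∫ y, k (x - y) * f y ∂μ := by
  have hm : Measurable (Function.uncurry fun x y => k (x - y) * f y) := by
    unfold Function.uncurry; fun_prop
  exact hm.stronglyMeasurable.integral_prod_right'.measurable

variable [μ.IsAddLeftInvariant] [μ.IsNegInvariant]

/-- Young's convolution inequality for nonnegative functions. -/
theorem lintegral_rpow_lintegral_sub_mul_le {k f : G → ℝ≥0∞} (hk : Measurable k)
    (hf : Measurable f) {s p q : ℝ} (hs : 0 < s) (hp : 0 < p) (hsq : s ≤ q) (hpq : p ≤ q)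
    (h : 1 / s + 1 / p = 1 + 1 / q) :
    ∫⁻ x, (∫⁻ y, k (x - y) * f y ∂μ) ^ q ∂μ ≤
      (∫⁻ x, k x ^ s ∂μ) ^ (q / s) * (∫⁻ x, f x ^ p ∂μ) ^ (q / p) := by
  have hq : 0 < q := hs.trans_le hsq
  set A := ∫⁻ x, k x ^ s ∂μ
  set B := ∫⁻ x, f x ^ p ∂μ
  have hs1 : 0 ≤ q / s - 1 := by rw [sub_nonneg, one_le_div hs]; exact hsq
  have hp1 : 0 ≤ q / p - 1 := by rw [sub_nonneg, one_le_div hp]; exact hpq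
  have key (x : G) : (∫⁻ y, k (x - y) * f y ∂μ) ^ q ≤
      (∫⁻ y, k (x - y) ^ s * f y ^ p ∂μ) * (A ^ (q / s - 1) * B ^ (q / p - 1)) := by
    have hkx : Measurable fun y => k (x - y) := by fun_prop
    have hA : ∫⁻ y, k (x - y) ^ s ∂μ = A := lintegral_sub_left_eq_self (fun z => k z ^ s) x
    have H := ENNReal.lintegral_prod_norm_pow_le (μ := μ) (Finset.univ : Finset (Fin 3))
      (f := ![fun y => k (x - y) ^ s * f y ^ p, fun y => k (x - y) ^ s, fun y => f y ^ p])
      (p := ![1 / q, 1 / s - 1 / q, 1 / p - 1 / q])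
      (by
        intro i _
        fin_cases i
        · exact ((hkx.pow_const s).mul (hf.pow_const p)).aemeasurable
        · exact (hkx.pow_const s).aemeasurable
        · exact (hf.pow_const p).aemeasurable)
      (by simp [Fin.sum_univ_three]; simp at h; linarith)
      (by
        intro i _
        fin_cases i
        · simp [hq.le]
        · simpa using inv_anti₀ hs hsq
        · simpa using inv_anti₀ hp hpq)
    simp only [Fin.prod_univ_three, Matrix.cons_val_zero, Matrix.cons_val_one,
      Matrix.cons_val, hA] at H
    have hpt (y : G) : (k (x - y) ^ s * f y ^ p) ^ (1 / q) * (k (x - y) ^ s) ^ (1 / s - 1 / q) *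
        (f y ^ p) ^ (1 / p - 1 / q) = k (x - y) * f y := by
      have h1 : 0 ≤ 1 / s - 1 / q := sub_nonneg.2 (one_div_le_one_div_of_le hs hsq)
      have h2 : 0 ≤ 1 / p - 1 / q := sub_nonneg.2 (one_div_le_one_div_of_le hp hpq)
      have h3 : 0 ≤ 1 / q := by positivity
      rw [ENNReal.mul_rpow_of_nonneg _ _ h3]
      calc _ = ((k (x - y) ^ s) ^ (1 / q) * (k (x - y) ^ s) ^ (1 / s - 1 / q)) *
            ((f y ^ p) ^ (1 / q) * (f y ^ p) ^ (1 / p - 1 / q)) := by ring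
        _ = _ := by
          rw [← ENNReal.rpow_add_of_nonneg _ _ h3 h1, ← ENNReal.rpow_add_of_nonneg _ _ h3 h2,
            add_sub_cancel, add_sub_cancel, one_div, one_div, ENNReal.rpow_rpow_inv hs.ne',
            ENNReal.rpow_rpow_inv hp.ne']
    simp only [hpt] at H
    refine (ENNReal.rpow_le_rpow H hq.le).trans_eq ?_
    rw [ENNReal.mul_rpow_of_nonneg _ _ hq.le, ENNReal.mul_rpow_of_nonneg _ _ hq.le,
      ← ENNReal.rpow_mul, ← ENNReal.rpow_mul, ← ENNReal.rpow_mul, one_div_mul_cancel hq.ne',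
      ENNReal.rpow_one, mul_assoc]
    congr 3 <;> field_simp
  calc _ ≤ ∫⁻ x, (∫⁻ y, k (x - y) ^ s * f y ^ p ∂μ) *
        (A ^ (q / s - 1) * B ^ (q / p - 1)) ∂μ := lintegral_mono key
    _ = (A * B) * (A ^ (q / s - 1) * B ^ (q / p - 1)) := by
      have hm : Measurable (Function.uncurry fun x y => k (x - y) ^ s * f y ^ p) := by
        unfold Function.uncurry; fun_prop
      have hm' : Measurable fun x => ∫⁻ y, k (x - y) ^ s * f y ^ p ∂μ := hm.lintegral_prod_right'
      rw [lintegral_mul_const _ hm', lintegral_lintegral_swap hm.aemeasurable]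
      congr 1
      have (y : G) : ∫⁻ x, k (x - y) ^ s * f y ^ p ∂μ = A * f y ^ p := by
        rw [lintegral_mul_const _ (by fun_prop), lintegral_sub_right_eq_self (fun z => k z ^ s)]
      simp only [this]
      rw [lintegral_const_mul _ (by fun_prop)]
    _ = (A ^ (1 : ℝ) * A ^ (q / s - 1)) * (B ^ (1 : ℝ) * B ^ (q / p - 1)) := by
      simp only [ENNReal.rpow_one]; ring
    _ = _ := by
      rw [← ENNReal.rpow_add_of_nonneg _ _ zero_le_one hs1,
        ← ENNReal.rpow_add_of_nonneg _ _ zero_le_one hp1, add_sub_cancel, add_sub_cancel]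

theorem lintegral_rpow_lintegral_enorm_sub_mul_le {k f : G → ℝ} (hk : Measurable k)
    (hf : Measurable f) {s p q : ℝ} (hs : 0 < s) (hp : 0 < p) (hsq : s ≤ q) (hpq : p ≤ q)
    (h : 1 / s + 1 / p = 1 + 1 / q) :
    (∫⁻ x, (∫⁻ y, ‖k (x - y) * f y‖ₑ ∂μ) ^ q ∂μ) ^ (1 / q) ≤
      eLpNorm k (ENNReal.ofReal s) μ * eLpNorm f (ENNReal.ofReal p) μ := by
  have hq : 0 < q := hs.trans_le hsq
  rw [eLpNorm_eq_lintegral_rpow_enorm_toReal (by simpa using hs) (by simp),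
    eLpNorm_eq_lintegral_rpow_enorm_toReal (by simpa using hp) (by simp),
    ENNReal.toReal_ofReal hs.le, ENNReal.toReal_ofReal hp.le]
  simp only [enorm_mul]
  refine (ENNReal.rpow_le_rpow (lintegral_rpow_lintegral_sub_mul_le (μ := μ) hk.enorm hf.enorm
    hs hp hsq hpq h) (by positivity)).trans_eq ?_
  rw [ENNReal.mul_rpow_of_nonneg _ _ (by positivity), ← ENNReal.rpow_mul, ← ENNReal.rpow_mul]
  congr 2 <;> field_simp

/-- Young's convolution inequality. -/
theorem eLpNorm_integral_sub_mul_le {k f : G → ℝ} (hk : Measurable k)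
    (hf : Measurable f) {s p q : ℝ} (hs : 0 < s) (hp : 0 < p) (hsq : s ≤ q) (hpq : p ≤ q)
    (h : 1 / s + 1 / p = 1 + 1 / q) :
    eLpNorm (fun x => ∫ y, k (x - y) * f y ∂μ) (ENNReal.ofReal q) μ ≤
      eLpNorm k (ENNReal.ofReal s) μ * eLpNorm f (ENNReal.ofReal p) μ := by
  have hq : 0 < q := hs.trans_le hsq
  refine le_trans ?_ (lintegral_rpow_lintegral_enorm_sub_mul_le hk hf hs hp hsq hpq h)
  rw [eLpNorm_eq_lintegral_rpow_enorm_toReal (by simpa using hq) (by simp),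
    ENNReal.toReal_ofReal hq.le]
  gcongr
  exact enorm_integral_le_lintegral_enorm _

theorem ae_integrable_sub_mul {k f : G → ℝ} (hk : Measurable k)
    (hf : Measurable f) {s p q : ℝ} (hs : 0 < s) (hp : 0 < p) (hsq : s ≤ q) (hpq : p ≤ q)
    (h : 1 / s + 1 / p = 1 + 1 / q) (hks : eLpNorm k (ENNReal.ofReal s) μ < ∞)
    (hfp : eLpNorm f (ENNReal.ofReal p) μ < ∞) :
    ∀ᵐ x ∂μ, Integrable (fun y => k (x - y) * f y) μ := by
  have hq : 0 < q := hs.trans_le hsq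
  have H := (lintegral_rpow_lintegral_enorm_sub_mul_le (μ := μ) hk hf hs hp hsq hpq h).trans_lt
    (ENNReal.mul_lt_top hks hfp)
  rw [ENNReal.rpow_lt_top_iff_of_pos (by positivity)] at H
  have hm : Measurable (Function.uncurry fun x y => ‖k (x - y) * f y‖ₑ) := by
    unfold Function.uncurry; fun_prop
  filter_upwards [ae_lt_top (hm.lintegral_prod_right'.pow_const q) H.ne] with x hx
  refine ⟨by fun_prop, ?_⟩
  exact (ENNReal.rpow_lt_top_iff_of_pos hq).1 hx

end Young

section Operators

/-- A linear integral operator with an a priori bound, localized to a set, is a continuous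
linear map between Lebesgue spaces. -/
theorem exists_clm_indicator_integral {α : Type*} [MeasurableSpace α] {μ : Measure α}
    {P Q : ℝ≥0∞} [Fact (1 ≤ P)] [Fact (1 ≤ Q)] {S : Set α} (hS : MeasurableSet S)
    (K : α → α → ℝ) (C : NNReal)
    (hint : ∀ f : Lp ℝ P μ, ∀ᵐ x ∂μ, Integrable (fun y => K x y * f y) μ)
    (hmeas : ∀ f : Lp ℝ P μ, AEStronglyMeasurable (fun x => ∫ y, K x y * f y ∂μ) μ)
    (hbound : ∀ f : Lp ℝ P μ,
      eLpNorm (S.indicator fun x => ∫ y, K x y * f y ∂μ) Q μ ≤ C * ‖f‖ₑ) :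
    ∃ N : Lp ℝ P μ →L[ℝ] Lp ℝ Q μ, ‖N‖ ≤ C ∧
      ∀ f, N f =ᵐ[μ] S.indicator fun x => ∫ y, K x y * f y ∂μ := by
  have hmem (f : Lp ℝ P μ) : MemLp (S.indicator fun x => ∫ y, K x y * f y ∂μ) Q μ :=
    ⟨(hmeas f).indicator hS, (hbound f).trans_lt (ENNReal.mul_lt_top (by simp) (by simp))⟩
  let L : Lp ℝ P μ →ₗ[ℝ] Lp ℝ Q μ :=
    { toFun := fun f => (hmem f).toLp
      map_add' := by
        intro f g
        ext1
        filter_upwards [(hmem (f + g)).coeFn_toLp, (hmem f).coeFn_toLp, (hmem g).coeFn_toLp,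
          Lp.coeFn_add (hmem f).toLp (hmem g).toLp, hint f, hint g] with x h1 h2 h3 h4 h5 h6
        rw [h1, h4, Pi.add_apply, h2, h3]
        by_cases hx : x ∈ S
        · simp only [Set.indicator_of_mem hx]
          rw [← integral_add h5 h6]
          refine integral_congr_ae ?_
          filter_upwards [Lp.coeFn_add f g] with y hy
          rw [hy, Pi.add_apply, mul_add]
        · simp [hx]
      map_smul' := by
        intro c f
        ext1
        filter_upwards [(hmem (c • f)).coeFn_toLp, (hmem f).coeFn_toLp,
          Lp.coeFn_smul c (hmem f).toLp] with x h1 h2 h3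
        rw [RingHom.id_apply, h1, h3, Pi.smul_apply, h2]
        by_cases hx : x ∈ S
        · simp only [Set.indicator_of_mem hx]
          rw [← integral_smul]
          refine integral_congr_ae ?_
          filter_upwards [Lp.coeFn_smul c f] with y hy
          rw [hy, Pi.smul_apply, smul_eq_mul, smul_eq_mul, mul_left_comm]
        · simp [hx] }
  have hL (f : Lp ℝ P μ) : ‖L f‖ ≤ C * ‖f‖ := by
    have : ‖L f‖ₑ ≤ C * ‖f‖ₑ :=
      (Lp.enorm_toLp (hmem f)).trans_le (hbound f)
    simpa [enorm_eq_nnnorm, ← ENNReal.coe_mul, ← NNReal.coe_le_coe] using this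
  exact ⟨L.mkContinuous C hL, L.mkContinuous_norm_le C.2 hL, fun f => (hmem f).coeFn_toLp⟩

/-- The bounded operator `f ↦ 1_S · (k * f)` from `L^p` to `L^t` given by Young's inequality,
on a set of finite measure. -/
theorem exists_clm_indicator_convolution {G : Type*} [AddCommGroup G] [MeasurableSpace G]
    [MeasurableAdd₂ G] [MeasurableNeg G] {μ : Measure G} [SFinite μ] [μ.IsAddLeftInvariant]
    [μ.IsNegInvariant] {P : ℝ≥0∞} [Fact (1 ≤ P)] {Q : ℝ≥0∞} [Fact (1 ≤ Q)]
    {S : Set G} (hS : MeasurableSet S) (hμS : μ S ≠ ∞) {k : G → ℝ} (hk : Measurable k)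
    {s p q : ℝ} (hP : P = ENNReal.ofReal p) (hs : 0 < s) (hp : 0 < p) (hsq : s ≤ q) (hpq : p ≤ q)
    (hQq : Q ≤ ENNReal.ofReal q)
    (h : 1 / s + 1 / p = 1 + 1 / q) (hks : eLpNorm k (ENNReal.ofReal s) μ < ∞) :
    ∃ N : Lp ℝ P μ →L[ℝ] Lp ℝ Q μ,
      ‖N‖ ≤ (eLpNorm k (ENNReal.ofReal s) μ * μ S ^ (1 / Q.toReal - 1 / q)).toReal ∧
      ∀ f, N f =ᵐ[μ] S.indicator fun x => ∫ y, k (x - y) * f y ∂μ := by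
  have hq : 0 < q := hs.trans_le hsq
  have hQ0 : 0 < Q.toReal :=
    ENNReal.toReal_pos (one_pos.trans_le Fact.out).ne' (hQq.trans_lt ENNReal.ofReal_lt_top).ne
  have hQq' : Q.toReal ≤ q := ENNReal.toReal_le_of_le_ofReal hq.le hQq
  have hfin : eLpNorm k (ENNReal.ofReal s) μ * μ S ^ (1 / Q.toReal - 1 / q) < ∞ :=
    ENNReal.mul_lt_top hks (ENNReal.rpow_lt_top_of_nonneg
      (sub_nonneg.2 (one_div_le_one_div_of_le hQ0 hQq')) hμS)
  have hmeas (f : Lp ℝ P μ) : Measurable fun x => ∫ y, k (x - y) * f y ∂μ :=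
    measurable_integral_sub_mul hk (Lp.stronglyMeasurable f).measurable
  refine exists_clm_indicator_integral hS (fun x y => k (x - y)) (ENNReal.toNNReal _)
    (fun f => ?_) (fun f => (hmeas f).aestronglyMeasurable) (fun f => ?_)
  · refine ae_integrable_sub_mul hk (Lp.stronglyMeasurable f).measurable hs hp hsq hpq h hks ?_
    rw [← hP]
    exact (Lp.memLp f).2
  · rw [ENNReal.coe_toNNReal hfin.ne, eLpNorm_indicator_eq_eLpNorm_restrict hS, Lp.enorm_def]
    refine (eLpNorm_le_eLpNorm_mul_rpow_measure_univ hQq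
      (hmeas f).aestronglyMeasurable).trans ?_
    rw [Measure.restrict_apply_univ, ENNReal.toReal_ofReal hq.le, mul_right_comm]
    gcongr
    refine (eLpNorm_restrict_le _ _ _ _).trans ?_
    have hfP : eLpNorm f P μ = eLpNorm f (ENNReal.ofReal p) μ := congrArg (eLpNorm f · μ) hP
    rw [hfP]
    exact eLpNorm_integral_sub_mul_le hk (Lp.stronglyMeasurable f).measurable hs hp hsq hpq h

/-- An operator whose kernel is an `L^q` function with values in the dual space is compact. -/
theorem exists_isCompactOperator_of_memLp_dual {V α : Type*} [NormedAddCommGroup V]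
    [NormedSpace ℝ V] [MeasurableSpace α] {μ : Measure α} {Q : ℝ≥0∞} [Fact (1 ≤ Q)] (hQ : Q ≠ ∞)
    {F : α → V →L[ℝ] ℝ} (hF : MemLp F Q μ) :
    ∃ T : V →L[ℝ] Lp ℝ Q μ, IsCompactOperator T ∧ ∀ v, T v =ᵐ[μ] fun x => F x v := by
  let Φ : Lp (V →L[ℝ] ℝ) Q μ →L[ℝ] V →L[ℝ] Lp ℝ Q μ :=
    LinearMap.mkContinuous₂
      (LinearMap.mk₂ ℝ (fun F v => (ContinuousLinearMap.apply ℝ ℝ v).compLpL Q μ F)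
        (fun _ _ _ => map_add _ _ _) (fun _ _ _ => map_smul _ _ _)
        (fun F v w => by rw [map_add, ContinuousLinearMap.add_compLpL]; rfl)
        (fun c F v => by rw [map_smul, ContinuousLinearMap.smul_compLpL]; rfl))
      1 (fun F v => by
        refine (ContinuousLinearMap.norm_compLp_le _ _).trans ?_
        rw [one_mul, mul_comm]
        gcongr
        refine ContinuousLinearMap.opNorm_le_bound _ (norm_nonneg _) fun L => ?_
        rw [mul_comm]
        exact L.le_opNorm v)
  have hΦ (F : Lp (V →L[ℝ] ℝ) Q μ) (v : V) : Φ F v =ᵐ[μ] fun x => F x v :=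
    (ContinuousLinearMap.apply ℝ ℝ v).coeFn_compLpL F
  have hc (F : Lp (V →L[ℝ] ℝ) Q μ) : IsCompactOperator (Φ F) := by
    induction F using Lp.induction hQ with
    | @indicatorConst c s hs hμs =>
      have : Φ (Lp.simpleFunc.indicatorConst Q hs hμs.ne c) =
          (ContinuousLinearMap.toSpanSingleton ℝ (indicatorConstLp Q hs hμs.ne (1 : ℝ))) ∘L c := by
        ext1 v
        ext1
        rw [Lp.simpleFunc.coe_indicatorConst]
        filter_upwards [hΦ (indicatorConstLp Q hs hμs.ne c) v,
          indicatorConstLp_coeFn (p := Q) (hs := hs) (hμs := hμs.ne) (c := c),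
          indicatorConstLp_coeFn (p := Q) (hs := hs) (hμs := hμs.ne) (c := (1 : ℝ)),
          Lp.coeFn_smul (c v) (indicatorConstLp Q hs hμs.ne (1 : ℝ))] with x h1 h2 h3 h4
        rw [h1, h2]
        simp only [ContinuousLinearMap.comp_apply, ContinuousLinearMap.toSpanSingleton_apply]
        rw [h4, Pi.smul_apply, h3]
        by_cases hx : x ∈ s <;> simp [hx]
      rw [this]
      exact (isCompactOperator_of_locallyCompactSpace_rng
        (ContinuousLinearMap.toSpanSingleton ℝ
          (indicatorConstLp Q hs hμs.ne (1 : ℝ)))).comp_clm c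
    | add hf hg _ ihf ihg =>
      rw [map_add]
      exact ihf.add ihg
    | isClosed => exact isClosed_setOfPred_isCompactOperator.preimage Φ.continuous
  refine ⟨Φ hF.toLp, hc _, fun v => ?_⟩
  filter_upwards [hΦ hF.toLp v, hF.coeFn_toLp] with x h1 h2
  rw [h1, h2]

theorem memLp_indicator_of_bound {α E : Type*} [MeasurableSpace α] {μ : Measure α}
    [NormedAddCommGroup E] {Q : ℝ≥0∞} {S : Set α} (hS : MeasurableSet S) (hμS : μ S ≠ ∞)
    {F : α → E} (hF : AEStronglyMeasurable F μ) (C : ℝ) (hC : ∀ x, ‖F x‖ ≤ C) :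
    MemLp (S.indicator F) Q μ := by
  have : IsFiniteMeasure (μ.restrict S) := isFiniteMeasure_restrict.2 hμS
  rw [memLp_indicator_iff_restrict hS]
  exact MemLp.of_bound hF.restrict C (ae_of_all _ hC)

/-- If `k` lies in the dual exponent then `f ↦ 1_S · (k * f)` is compact, for `S` of finite
measure. -/
theorem exists_isCompactOperator_indicator_convolution {G : Type*} [NormedAddCommGroup G]
    [LocallyCompactSpace G] [SecondCountableTopology G] [MeasurableSpace G] [BorelSpace G]
    {μ : Measure G} [IsLocallyFiniteMeasure μ] [μ.InnerRegularCompactLTTop]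
    [μ.IsAddLeftInvariant] [μ.IsNegInvariant]
    {P P' Q : ℝ≥0∞} [Fact (1 ≤ P)] [Fact (1 ≤ P')] [Fact (1 ≤ Q)] [ENNReal.HolderConjugate P' P]
    (hP' : P' ≠ ∞) (hQ : Q ≠ ∞) {S : Set G} (hS : MeasurableSet S) (hμS : μ S ≠ ∞)
    {k : G → ℝ} (hk : MemLp k P' μ) :
    ∃ T : Lp ℝ P μ →L[ℝ] Lp ℝ Q μ, IsCompactOperator T ∧
      ∀ f, T f =ᵐ[μ] S.indicator fun x => ∫ y, k (x - y) * f y ∂μ := by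
  let g : C(G, C(G, G)) := (ContinuousMap.mk (fun a : G × G => a.1 - a.2) continuous_sub).curry
  have hg (x : G) : MeasurePreserving (g x) μ μ := Measure.measurePreserving_sub_left μ x
  let τ : G → Lp ℝ P' μ := fun x => Lp.compMeasurePreserving (g x) (hg x) hk.toLp
  have hτ : Continuous τ := continuous_const.compMeasurePreservingLp g.continuous hg hP'
  have hτn (x : G) : ‖τ x‖ = ‖hk.toLp‖ := Lp.norm_compMeasurePreserving _ _
  have hτk (x : G) : τ x =ᵐ[μ] fun y => k (x - y) :=
    (Lp.coeFn_compMeasurePreserving _ (hg x)).trans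
      ((hg x).quasiMeasurePreserving.ae_eq_comp hk.coeFn_toLp)
  let B := (ContinuousLinearMap.mul ℝ ℝ).lpPairing μ P' P
  have hBm : StronglyMeasurable fun x => B (τ x) := (B.continuous.comp hτ).stronglyMeasurable
  have hF : MemLp (S.indicator fun x => B (τ x)) Q μ :=
    memLp_indicator_of_bound hS hμS hBm.aestronglyMeasurable (‖B‖ * ‖hk.toLp‖)
      fun x => (B.le_opNorm _).trans_eq (by rw [hτn x])
  obtain ⟨T, hT, hTf⟩ := exists_isCompactOperator_of_memLp_dual hQ hF
  refine ⟨T, hT, fun f => (hTf f).trans (ae_of_all _ fun x => ?_)⟩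
  by_cases hx : x ∈ S
  · simp only [Set.indicator_of_mem hx, B, ContinuousLinearMap.lpPairing_eq_integral,
      ContinuousLinearMap.mul_apply']
    refine integral_congr_ae ?_
    filter_upwards [hτk x] with y hy
    rw [hy]
  · simp [hx]

end Operators

section Kernel

open Filter Topology

theorem measurable_Psi5 : Measurable Psi5 := by
  unfold Psi5; fun_prop

theorem abs_Psi5_le (x : E5) : |Psi5 x| ≤ (1 + ‖x‖) / ‖x‖ ^ 3 := by
  have hpi : 1 ≤ 8 * Real.pi ^ 2 := by nlinarith [Real.pi_gt_three]
  have hnum : |Real.cos ‖x‖ + ‖x‖ * Real.sin ‖x‖| ≤ 1 + ‖x‖ := by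
    refine (abs_add_le _ _).trans (add_le_add (Real.abs_cos_le_one _) ?_)
    rw [abs_mul, abs_norm]
    exact mul_le_of_le_one_right (norm_nonneg x) (Real.abs_sin_le_one _)
  have hden : |8 * Real.pi ^ 2 * ‖x‖ ^ 3| = 8 * Real.pi ^ 2 * ‖x‖ ^ 3 :=
    abs_of_nonneg (by positivity)
  rw [Psi5, abs_div, hden, ← div_div, div_right_comm]
  refine (div_le_self (by positivity) hpi).trans ?_
  gcongr

/-- `Psi5` is in `L^s` near the origin for `s < 5/3`. -/
theorem memLp_indicator_ball_Psi5 {s : ℝ} (hs : 0 < s) (hs' : s < 5 / 3) :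
    MemLp ((ball (0 : E5) 1).indicator Psi5) (ENNReal.ofReal s) volume := by
  have hint : IntegrableOn (fun x : E5 => ((2 : ℝ) * ‖x‖ ^ (-3 : ℝ)) ^ s) (ball 0 1) := by
    rw [integrableOn_fun_norm_addHaar volume (f := fun y : ℝ => ((2 : ℝ) * y ^ (-3 : ℝ)) ^ s)]
    have h := ((intervalIntegral.integrableOn_Ioo_rpow_iff (s := 4 - 3 * s) one_pos).2
      (by linarith)).const_mul (2 ^ s)
    refine IntegrableOn.congr_fun h (fun y hy => ?_) measurableSet_Ioo
    have hy0 : 0 < y := hy.1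
    simp only [finrank_euclideanSpace, Fintype.card_fin, smul_eq_mul]
    rw [Real.mul_rpow zero_le_two (Real.rpow_nonneg hy0.le _), ← Real.rpow_mul hy0.le,
      mul_left_comm, ← Real.rpow_natCast, ← Real.rpow_add hy0]
    congr 2
    norm_num
    ring
  rw [memLp_indicator_iff_restrict measurableSet_ball,
    ← integrable_norm_rpow_iff measurable_Psi5.aestronglyMeasurable (by simpa using hs) (by simp),
    ENNReal.toReal_ofReal hs.le]
  refine Integrable.mono' hint
    (measurable_Psi5.norm.pow_const s).aestronglyMeasurable ?_
  filter_upwards [ae_restrict_mem measurableSet_ball] with x hx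
  rw [Real.norm_of_nonneg (by positivity)]
  have hx1 : ‖x‖ < 1 := by simpa using hx
  gcongr
  rw [Real.norm_eq_abs, Real.rpow_neg (norm_nonneg x), ← div_eq_mul_inv]
  refine (abs_Psi5_le x).trans ?_
  norm_cast
  gcongr
  linarith

/-- `Psi5` is in `L^{10/3}` away from the origin. -/
theorem memLp_indicator_compl_ball_Psi5 {δ : ℝ} (hδ : 0 < δ) :
    MemLp ((ball (0 : E5) δ)ᶜ.indicator Psi5) (ENNReal.ofReal (10 / 3)) volume := by
  have hJ : MemLp (fun x : E5 => (1 + ‖x‖) ^ (-2 : ℝ)) (ENNReal.ofReal (10 / 3)) volume := by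
    rw [← integrable_norm_rpow_iff
      (Measurable.aestronglyMeasurable (by fun_prop)) (by simp) (by simp),
      ENNReal.toReal_ofReal (by norm_num)]
    refine (integrable_one_add_norm (μ := (volume : Measure E5)) (r := 20 / 3)
      (by simp; norm_num)).congr (ae_of_all _ fun x => ?_)
    have : 0 ≤ 1 + ‖x‖ := by positivity
    simp only
    rw [Real.norm_of_nonneg (by positivity), ← Real.rpow_mul this]
    norm_num
  refine (hJ.const_mul ((1 + 1 / δ) ^ 3)).mono'
    (measurable_Psi5.indicator measurableSet_ball.compl).aestronglyMeasurable
    (ae_of_all _ fun x => ?_)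
  by_cases hx : x ∈ (ball (0 : E5) δ)ᶜ
  · rw [Set.indicator_of_mem hx, Real.norm_eq_abs]
    have hxδ : δ ≤ ‖x‖ := by simpa using hx
    have hx0 : 0 < ‖x‖ := hδ.trans_le hxδ
    refine (abs_Psi5_le x).trans ?_
    have h1 : 1 + ‖x‖ ≤ (1 + 1 / δ) * ‖x‖ := by
      have : 1 ≤ 1 / δ * ‖x‖ := by
        rw [one_div, inv_mul_eq_div, one_le_div hδ]; exact hxδ
      linarith
    have h2 : (1 + ‖x‖) ^ 3 ≤ (1 + 1 / δ) ^ 3 * ‖x‖ ^ 3 := by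
      rw [← mul_pow]; gcongr
    rw [Real.rpow_neg (by positivity), ← div_eq_mul_inv, div_le_div_iff₀ (by positivity)
      (Real.rpow_pos_of_pos (by positivity) _)]
    norm_cast
    calc (1 + ‖x‖) * (1 + ‖x‖) ^ 2 = (1 + ‖x‖) ^ 3 := by ring
      _ ≤ _ := h2
  · rw [Set.indicator_of_notMem hx, norm_zero]
    positivity

theorem ten_div_seven_eq_ofReal : (10 / 7 : ℝ≥0∞) = ENNReal.ofReal (10 / 7) := by
  rw [ENNReal.ofReal_div_of_pos (by norm_num)]; norm_num

theorem holderConjugate_ten_thirds :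
    ENNReal.HolderConjugate (ENNReal.ofReal (10 / 3)) (10 / 7) := by
  rw [ten_div_seven_eq_ofReal]
  refine Real.HolderConjugate.ennrealOfReal ?_
  rw [Real.holderConjugate_iff]
  norm_num

theorem integrable_compl_ball_Psi5_sub_mul {δ : ℝ} (hδ : 0 < δ)
    (f : Lp ℝ (10 / 7 : ℝ≥0∞) (volume : Measure E5)) (x : E5) :
    Integrable fun y => (ball (0 : E5) δ)ᶜ.indicator Psi5 (x - y) * f y := by
  have := holderConjugate_ten_thirds
  exact ((memLp_indicator_compl_ball_Psi5 hδ).comp_measurePreserving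
    (Measure.measurePreserving_sub_left volume x)).integrable_mul (Lp.memLp f)

/-- The exponents `s`, `q` for which Young's inequality bounds the local part of `Psi5`. -/
theorem exists_young_exponents {t : ℝ} (ht : t < 10 / 3) :
    ∃ s q : ℝ, 1 ≤ s ∧ s < 5 / 3 ∧ s ≤ q ∧ 10 / 7 ≤ q ∧ t ≤ q ∧
      1 / s + 1 / (10 / 7) = 1 + 1 / q := by
  have hq2 : 2 ≤ max t 2 := le_max_right _ _
  have hq3 : max t 2 < 10 / 3 := max_lt ht (by norm_num)
  have htq : t ≤ max t 2 := le_max_left _ _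
  generalize max t 2 = q at *
  have hq : 0 < q := by linarith
  have h1 : 3 / 10 < 1 / q := by rw [lt_div_iff₀ hq]; linarith
  have h2 : 1 / q ≤ 1 / 2 := one_div_le_one_div_of_le two_pos hq2
  have hpos : 0 < 3 / 10 + 1 / q := by linarith
  refine ⟨1 / (3 / 10 + 1 / q), q, ?_, ?_, ?_, by linarith, htq, ?_⟩
  · rw [le_div_iff₀ hpos]; linarith
  · rw [div_lt_iff₀ hpos]; linarith
  · refine le_trans ?_ hq2
    rw [div_le_iff₀ hpos]; linarith
  · rw [one_div_one_div]; ring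

theorem indicator_ball_Psi5_add_compl (δ : ℝ) (x : E5) :
    Psi5 x = (ball (0 : E5) δ).indicator Psi5 x + (ball (0 : E5) δ)ᶜ.indicator Psi5 x :=
  (congrFun (Set.indicator_self_add_compl _ _) x).symm

theorem memLp_indicator_ball_Psi5_of_le {s δ : ℝ} (hs : 0 < s) (hs' : s < 5 / 3) (hδ : δ ≤ 1) :
    MemLp ((ball (0 : E5) δ).indicator Psi5) (ENNReal.ofReal s) volume := by
  have h := (memLp_indicator_ball_Psi5 hs hs').indicator
    (measurableSet_ball (x := (0 : E5)) (ε := δ))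
  rwa [Set.indicator_indicator, Set.inter_eq_left.2 (ball_subset_ball hδ)] at h

theorem ae_integrable_ball_Psi5_sub_mul {δ : ℝ} (hδ : δ ≤ 1)
    (f : Lp ℝ (10 / 7 : ℝ≥0∞) (volume : Measure E5)) :
    ∀ᵐ x : E5, Integrable fun y => (ball (0 : E5) δ).indicator Psi5 (x - y) * f y := by
  obtain ⟨s, q, hs, hs', hsq, hpq, -, h⟩ := exists_young_exponents (t := 1) (by norm_num)
  refine ae_integrable_sub_mul (measurable_Psi5.indicator measurableSet_ball)
    (Lp.stronglyMeasurable f).measurable (by linarith) (by norm_num) hsq hpq h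
    (memLp_indicator_ball_Psi5_of_le (by linarith) hs' hδ).2 ?_
  rw [← ten_div_seven_eq_ofReal]
  exact (Lp.memLp f).2

theorem ae_integrable_Psi5_sub_mul (f : Lp ℝ (10 / 7 : ℝ≥0∞) (volume : Measure E5)) :
    ∀ᵐ x : E5, Integrable fun y => Psi5 (x - y) * f y := by
  filter_upwards [ae_integrable_ball_Psi5_sub_mul le_rfl f] with x hx
  refine (hx.add (integrable_compl_ball_Psi5_sub_mul one_pos f x)).congr (ae_of_all _ fun y => ?_)
  rw [Pi.add_apply, ← add_mul, ← indicator_ball_Psi5_add_compl]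

/-- The localized convolution with `Psi5` is a compact operator plus an operator of arbitrarily
small norm. -/
theorem exists_clm_convolution_Psi5_norm_sub_le {t : ℝ} [Fact (1 ≤ ENNReal.ofReal t)]
    (ht : t < 10 / 3) (r : ℝ) {ε : ℝ} (hε : 0 < ε) :
    ∃ A T : Lp ℝ (10 / 7 : ℝ≥0∞) (volume : Measure E5) →L[ℝ]
        Lp ℝ (ENNReal.ofReal t) (volume : Measure E5),
      IsCompactOperator T ∧ ‖A - T‖ ≤ ε ∧
      ∀ f, A f =ᵐ[volume] (ball (0 : E5) r).indicator fun x => ∫ y, Psi5 (x - y) * f y := by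
  obtain ⟨s, q, hs, hs', hsq, hpq, htq, h⟩ := exists_young_exponents ht
  have hs0 : 0 < s := by linarith
  have hμ : volume (ball (0 : E5) r) ≠ ∞ := measure_ball_lt_top.ne
  set c := (volume (ball (0 : E5) r) ^ (1 / (ENNReal.ofReal t).toReal - 1 / q)).toReal
  have hc : 0 < c + 1 := by positivity
  obtain ⟨η, hη, hsmall⟩ := (memLp_indicator_ball_Psi5 hs0 hs').eLpNorm_indicator_le
    (by simpa using hs) (by simp) (div_pos hε hc)
  obtain ⟨δ, hδ, hδ1, hδη⟩ : ∃ δ, 0 < δ ∧ δ ≤ 1 ∧ volume (ball (0 : E5) δ) ≤ ENNReal.ofReal η := by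
    have hvol : Tendsto (fun δ : ℝ => volume (ball (0 : E5) δ)) (𝓝[>] 0) (𝓝 0) := by
      have h0 : Tendsto (fun δ : ℝ => ENNReal.ofReal (δ ^ 5) * volume (ball (0 : E5) 1)) (𝓝 0)
          (𝓝 (ENNReal.ofReal (0 ^ 5) * volume (ball (0 : E5) 1))) :=
        ENNReal.Tendsto.mul_const
          (ENNReal.tendsto_ofReal ((continuous_pow 5).tendsto 0)) (.inr measure_ball_lt_top.ne)
      rw [zero_pow (by norm_num), ENNReal.ofReal_zero, zero_mul] at h0
      refine (h0.mono_left nhdsWithin_le_nhds).congr' ?_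
      filter_upwards [self_mem_nhdsWithin] with δ hδ
      rw [Measure.addHaar_ball_of_pos volume 0 hδ, finrank_euclideanSpace, Fintype.card_fin]
    have h1 := hvol.eventually (ge_mem_nhds (ENNReal.ofReal_pos.2 hη))
    obtain ⟨δ, hδ, hδ1⟩ := (h1.and (Ioc_mem_nhdsGT one_pos)).exists
    exact ⟨δ, hδ1.1, hδ1.2, hδ⟩
  have hnear : eLpNorm ((ball (0 : E5) δ).indicator Psi5) (ENNReal.ofReal s) volume ≤
      ENNReal.ofReal (ε / (c + 1)) := by
    have := hsmall _ measurableSet_ball hδη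
    rwa [Set.indicator_indicator, Set.inter_eq_left.2 (ball_subset_ball hδ1)] at this
  obtain ⟨N, hN, hNf⟩ := exists_clm_indicator_convolution (P := 10 / 7) (Q := ENNReal.ofReal t)
    measurableSet_ball hμ
    (measurable_Psi5.indicator (measurableSet_ball (x := (0 : E5)) (ε := δ)))
    ten_div_seven_eq_ofReal hs0 (by norm_num) hsq hpq (ENNReal.ofReal_le_ofReal htq) h
    (memLp_indicator_ball_Psi5_of_le hs0 hs' hδ1).2
  have := holderConjugate_ten_thirds
  have : Fact (1 ≤ ENNReal.ofReal (10 / 3)) := ⟨by norm_num⟩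
  obtain ⟨T, hT, hTf⟩ := exists_isCompactOperator_indicator_convolution (P := 10 / 7)
    (Q := ENNReal.ofReal t) (by simp) (by simp) measurableSet_ball hμ
    (memLp_indicator_compl_ball_Psi5 hδ)
  refine ⟨N + T, T, hT, ?_, fun f => ?_⟩
  · rw [add_sub_cancel_right]
    refine hN.trans ?_
    rw [ENNReal.toReal_mul]
    calc _ ≤ ε / (c + 1) * c := by
          gcongr
          exact ENNReal.toReal_le_of_le_ofReal (by positivity) hnear
      _ ≤ ε / (c + 1) * (c + 1) := by gcongr; linarith
      _ = ε := div_mul_cancel₀ _ hc.ne'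
  · filter_upwards [hNf f, hTf f, Lp.coeFn_add (N f) (T f),
      ae_integrable_ball_Psi5_sub_mul hδ1 f] with x h1 h2 h3 h4
    rw [_root_.add_apply, h3, Pi.add_apply, h1, h2]
    by_cases hx : x ∈ ball (0 : E5) r
    · simp only [Set.indicator_of_mem hx]
      rw [← integral_add h4 (integrable_compl_ball_Psi5_sub_mul hδ f x)]
      refine integral_congr_ae (ae_of_all _ fun y => ?_)
      simp only
      rw [indicator_ball_Psi5_add_compl δ, add_mul]
    · simp only [Set.indicator_of_notMem hx, add_zero]

theorem exists_isCompactOperator_convolution_Psi5 {t : ℝ} [Fact (1 ≤ ENNReal.ofReal t)]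
    (ht : t < 10 / 3) (r : ℝ) :
    ∃ T : Lp ℝ (10 / 7 : ℝ≥0∞) (volume : Measure E5) →L[ℝ]
        Lp ℝ (ENNReal.ofReal t) (volume : Measure E5),
      IsCompactOperator T ∧
      ∀ f, T f =ᵐ[volume] (ball (0 : E5) r).indicator fun x => ∫ y, Psi5 (x - y) * f y := by
  obtain ⟨A, -, -, -, hA⟩ := exists_clm_convolution_Psi5_norm_sub_le ht r one_pos
  refine ⟨A, ?_, hA⟩
  refine isClosed_setOfPred_isCompactOperator.closure_subset (Metric.mem_closure_iff.2 ?_)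
  intro ε hε
  obtain ⟨A', T, hT, hle, hA'⟩ := exists_clm_convolution_Psi5_norm_sub_le ht r (half_pos hε)
  have hAA' : A = A' := ContinuousLinearMap.ext fun f => Lp.ext ((hA f).trans (hA' f).symm)
  refine ⟨T, hT, ?_⟩
  rw [dist_eq_norm, hAA']
  linarith

end Kernel

/-- Lemma 2.2, five-dimensional case: for `f ∈ L^{10/7}(ℝ⁵)` the convolution `Ψ * f`
converges absolutely a.e., and for every `r > 0` and `1 ≤ t < 10/3` the operator
`f ↦ 1_{B_r}·(Ψ * f)` is a well-defined, bounded and compact linear operator from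
`L^{10/7}(ℝ⁵)` to `L^t(ℝ⁵)`. -/
theorem stmt5 :
    (∀ f : Lp ℝ (10/7 : ℝ≥0∞) (volume : Measure E5),
      ∀ᵐ x : E5, Integrable (fun y => Psi5 (x - y) * (f : E5 → ℝ) y)) ∧
    (∀ r : ℝ, 0 < r → ∀ t : ℝ, ∀ ht : 1 ≤ t, t < 10/3 →
      haveI : Fact ((1 : ℝ≥0∞) ≤ ENNReal.ofReal t) :=
        ⟨ENNReal.ofReal_one ▸ ENNReal.ofReal_le_ofReal ht⟩
      ∃ T : Lp ℝ (10/7 : ℝ≥0∞) (volume : Measure E5) →L[ℝ]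
            Lp ℝ (ENNReal.ofReal t) (volume : Measure E5),
        IsCompactOperator T ∧
        ∀ f, (T f : E5 → ℝ) =ᵐ[volume]
          (ball (0 : E5) r).indicator
            (fun x => ∫ y, Psi5 (x - y) * (f : E5 → ℝ) y)) := by
  refine ⟨ae_integrable_Psi5_sub_mul, fun r _ t ht ht' => ?_⟩
  have : Fact ((1 : ℝ≥0∞) ≤ ENNReal.ofReal t) :=
    ⟨ENNReal.ofReal_one ▸ ENNReal.ofReal_le_ofReal ht⟩
  exact exists_isCompactOperator_convolution_Psi5 ht' r

end
end

section
/- Let Ψ(x) := (cos|x| + |x|·sin|x|)/(8π²|x|³) and Λ(x) := 1/(8π²|x|³) on ℝ⁵∖{0}. For every f ∈ L^{10/7}(ℝ⁵) the convolution ((Ψ−Λ)*f)(x) := ∫_{ℝ⁵}(Ψ−Λ)(x−y)f(y) dy converges absolutely for almost every x, and for every r > 0 the linear operator from L^{10/7}(ℝ⁵) to L^{10/3}(ℝ⁵) given by f ↦ 1_{B_r}·((Ψ−Λ)*f) is well defined, bounded, and compact (it maps bounded sets to relatively compact sets). -/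
open MeasureTheory Real Metric
open scoped ENNReal

noncomputable section

/-- The fundamental solution of `-Δ` on `ℝ⁵`. -/
def Lambda5 (x : E5) : ℝ :=
  1 / (8 * Real.pi ^ 2 * ‖x‖ ^ 3)

instance : Fact ((1 : ℝ≥0∞) ≤ 10/3) :=
  ⟨by rw [ENNReal.le_div_iff_mul_le (by norm_num) (by norm_num)]; norm_num⟩

/-- A norm-continuous family of functionals on a compact space induces a compact operator into
the space of continuous functions. -/
lemma exists_isCompactOperator_boundedContinuous {X F : Type*} [TopologicalSpace X] [CompactSpace X]
    [NormedAddCommGroup F] [NormedSpace ℝ F] (φ : X → F →L[ℝ] ℝ) (hφ : Continuous φ) :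
    ∃ S : F →L[ℝ] BoundedContinuousFunction X ℝ,
      IsCompactOperator S ∧ ∀ f x, S f x = φ x f := by
  have hbound : ∃ C, 0 ≤ C ∧ ∀ x, ‖φ x‖ ≤ C := by
    let ψ := BoundedContinuousFunction.mkOfCompact ⟨φ, hφ⟩
    exact ⟨‖ψ‖, norm_nonneg ψ, ψ.norm_coe_le_norm⟩
  obtain ⟨C, hC, hφC⟩ := hbound
  let S₀ : F →ₗ[ℝ] BoundedContinuousFunction X ℝ :=
    { toFun := fun f => BoundedContinuousFunction.mkOfCompact
        ⟨fun x => φ x f, hφ.clm_apply continuous_const⟩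
      map_add' := fun f g => by ext x; simp
      map_smul' := fun c f => by ext x; simp }
  have hS₀ : ∀ f x, |φ x f| ≤ C * ‖f‖ := fun f x => (φ x).le_of_opNorm_le (hφC x) f
  let S : F →L[ℝ] BoundedContinuousFunction X ℝ := S₀.mkContinuous C fun f =>
    (BoundedContinuousFunction.norm_le (by positivity)).2 (hS₀ f)
  have hS : ∀ f x, S f x = φ x f := fun _ _ => rfl
  refine ⟨S, ?_, hS⟩
  refine (isCompactOperator_iff_isCompact_closure_image_closedBall
    (S : F →ₗ[ℝ] BoundedContinuousFunction X ℝ) one_pos).2 ?_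
  refine BoundedContinuousFunction.arzela_ascoli (closedBall 0 C) (isCompact_closedBall _ _) _ ?_ ?_
  · rintro _ x ⟨f, hf, rfl⟩
    rw [mem_closedBall_zero_iff] at hf ⊢
    exact (hS₀ f x).trans (mul_le_of_le_one_right hC hf)
  · intro x₀
    rw [Metric.equicontinuousAt_iff_right]
    intro ε hε
    filter_upwards [(Metric.tendsto_nhds.1 (hφ.tendsto x₀)) ε hε] with x hx
    rintro ⟨_, f, hf, rfl⟩
    rw [mem_closedBall_zero_iff] at hf
    change dist (φ x₀ f) (φ x f) < ε
    rw [dist_comm, dist_eq_norm, ← sub_apply]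
    rw [dist_eq_norm] at hx
    exact ((φ x - φ x₀).le_opNorm f |>.trans
      (mul_le_of_le_one_right (norm_nonneg _) hf)).trans_lt hx

/-- Continuous functions on a set `K`, cut off to a finite-measure subset `B` and extended by zero,
embed continuously into `Lᵖ`. -/
lemma exists_clm_indicator_extend {α : Type*} [TopologicalSpace α] [MeasurableSpace α]
    [BorelSpace α] {μ : Measure α} {p : ℝ≥0∞} [Fact (1 ≤ p)] {K B : Set α}
    (hK : MeasurableSet K) (hB : MeasurableSet B) (hBK : B ⊆ K) (hμB : μ B ≠ ∞) :
    ∃ J : BoundedContinuousFunction K ℝ →L[ℝ] Lp ℝ p μ,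
      ∀ g, (J g : α → ℝ) =ᵐ[μ] B.indicator (Function.extend Subtype.val g 0) := by
  let e : BoundedContinuousFunction K ℝ → α → ℝ :=
    fun g => B.indicator (Function.extend Subtype.val g 0)
  have he : ∀ g x (hx : x ∈ B), e g x = g ⟨x, hBK hx⟩ := fun g x hx => by
    simp only [e, Set.indicator_of_mem hx]
    exact Subtype.val_injective.extend_apply g 0 ⟨x, hBK hx⟩
  have he' : ∀ g x, x ∉ B → e g x = 0 := fun g x hx => Set.indicator_of_notMem hx _
  have hle : ∀ g x, ‖e g x‖ ≤ ‖B.indicator (fun _ => ‖g‖) x‖ := fun g x => by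
    by_cases hx : x ∈ B
    · rw [he g x hx, Set.indicator_of_mem hx, norm_norm]
      exact g.norm_coe_le_norm _
    · simp [he' g x hx]
  have hind : ∀ c : ℝ, MemLp (B.indicator fun _ => c) p μ :=
    fun c => memLp_indicator_const p hB c (Or.inr hμB)
  have hmem : ∀ g, MemLp (e g) p μ := fun g => (hind ‖g‖).mono
    (((MeasurableEmbedding.subtype_coe hK).measurable_extend g.continuous.measurable
      measurable_const).indicator hB).aestronglyMeasurable (ae_of_all _ (hle g))
  let J₀ : BoundedContinuousFunction K ℝ →ₗ[ℝ] Lp ℝ p μ :=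
    { toFun := fun g => (hmem g).toLp (e g)
      map_add' := fun g h => by
        rw [← MemLp.toLp_add]
        congr 1
        ext x
        by_cases hx : x ∈ B
        · simp [he _ x hx]
        · simp [he' _ x hx]
      map_smul' := fun c g => by
        rw [RingHom.id_apply, ← MemLp.toLp_const_smul]
        congr 1
        ext x
        by_cases hx : x ∈ B
        · simp [he _ x hx]
        · simp [he' _ x hx] }
  refine ⟨J₀.mkContinuous ‖indicatorConstLp p hB hμB (1 : ℝ)‖ fun g => ?_,
    fun g => (hmem g).coeFn_toLp⟩
  rw [mul_comm]
  refine Lp.norm_le_mul_norm_of_ae_le_mul ?_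
  filter_upwards [(hmem g).coeFn_toLp, indicatorConstLp_coeFn (p := p) (hs := hB) (hμs := hμB)
    (c := (1 : ℝ))] with x hx hx'
  change ‖(hmem g).toLp (e g) x‖ ≤ _
  rw [hx, hx']
  refine (hle g x).trans ?_
  by_cases hxB : x ∈ B <;> simp [hxB]

section Convolution

variable {p q : ℝ≥0∞} {k : E5 → ℝ}

/-- Convolution with an `Lᵖ` kernel converges absolutely at every point on the conjugate
space. -/
lemma integrable_convolution_of_memLp [p.HolderConjugate q] (hk : MemLp k p volume)
    (f : Lp ℝ q (volume : Measure E5)) (x : E5) :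
    Integrable (fun y => k (x - y) * f y) := by
  have h : MemLp (fun y => k (x - y)) p volume :=
    hk.comp_measurePreserving (Measure.measurePreserving_sub_left volume x)
  exact h.integrable_mul (Lp.memLp f)

/-- Convolution with an even `Lᵖ` kernel, localized to a ball, is a compact operator from the
conjugate space to `Lˢ`. -/
lemma exists_isCompactOperator_convolution [p.HolderConjugate q] [Fact (1 ≤ p)] [Fact (p ≠ ∞)]
    [Fact (1 ≤ q)] {s : ℝ≥0∞} [Fact (1 ≤ s)] (hk : MemLp k p volume)
    (heven : ∀ x, k (-x) = k x) (r : ℝ) :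
    ∃ T : Lp ℝ q (volume : Measure E5) →L[ℝ] Lp ℝ s (volume : Measure E5),
      IsCompactOperator T ∧
      ∀ f, (T f : E5 → ℝ) =ᵐ[volume]
        (ball (0 : E5) r).indicator (fun x => ∫ y, k (x - y) * f y) := by
  let P := (ContinuousLinearMap.mul ℝ ℝ).lpPairing (volume : Measure E5) p q
  let G : E5 → Lp ℝ p (volume : Measure E5) := fun x => DomAddAct.mk (-x) +ᵥ hk.toLp
  have hG : Continuous G :=
    (DomAddAct.continuous_mk.comp continuous_neg).vadd continuous_const
  have hGcoe : ∀ x, G x =ᵐ[volume] fun y => k (x - y) := fun x => by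
    have h : G x = _ := DomAddAct.mk_vadd_toLp (-x) hk
    rw [h]
    refine (MemLp.coeFn_toLp _).trans (ae_of_all _ fun y => ?_)
    change k (-x + y) = k (x - y)
    rw [← heven]
    congr 1
    abel
  have hP : ∀ x f, P (G x) f = ∫ y, k (x - y) * f y := fun x f => by
    rw [ContinuousLinearMap.lpPairing_eq_integral]
    refine integral_congr_ae ?_
    filter_upwards [hGcoe x] with y hy
    simp [hy]
  have : CompactSpace (closedBall (0 : E5) r) :=
    isCompact_iff_compactSpace.1 (isCompact_closedBall _ _)
  obtain ⟨S, hSc, hS⟩ := exists_isCompactOperator_boundedContinuous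
    (fun x : closedBall (0 : E5) r => P (G x)) (P.continuous.comp (hG.comp continuous_subtype_val))
  obtain ⟨J, hJ⟩ := exists_clm_indicator_extend (μ := (volume : Measure E5)) (p := s)
    (measurableSet_closedBall (x := (0 : E5)) (ε := r)) measurableSet_ball ball_subset_closedBall
    measure_ball_lt_top.ne
  refine ⟨J ∘L S, hSc.clm_comp J, fun f => (hJ (S f)).trans (ae_of_all _ fun x => ?_)⟩
  by_cases hx : x ∈ ball (0 : E5) r
  · rw [Set.indicator_of_mem hx, Set.indicator_of_mem hx, ← hP]
    exact (Subtype.val_injective.extend_apply (S f) 0 ⟨x, ball_subset_closedBall hx⟩).trans (hS _ _)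
  · rw [Set.indicator_of_notMem hx, Set.indicator_of_notMem hx]

end Convolution

/-- The radial profile of `Psi5 - Lambda5`. -/
def diffProfile (t : ℝ) : ℝ :=
  (Real.cos t + t * Real.sin t - 1) / (8 * Real.pi ^ 2 * t ^ 3)

lemma Psi5_sub_Lambda5 (x : E5) : Psi5 x - Lambda5 x = diffProfile ‖x‖ := by
  rw [Psi5, Lambda5, diffProfile, sub_div]

lemma two_le_eight_mul_pi_sq : 2 ≤ 8 * Real.pi ^ 2 := by
  nlinarith [Real.pi_gt_three]

lemma abs_diffProfile_le_inv {t : ℝ} (ht : 0 < t) : |diffProfile t| ≤ t⁻¹ := by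
  have hpi := two_le_eight_mul_pi_sq
  have hnum : |Real.cos t + t * Real.sin t - 1| ≤ 2 * t ^ 2 := by
    have h1 := Real.one_sub_sq_div_two_le_cos (x := t)
    have h2 := Real.cos_le_one t
    have h3 := abs_le.1 ((Real.abs_sin_le_abs (x := t)).trans_eq (abs_of_pos ht))
    rw [abs_le]
    constructor <;> nlinarith
  rw [diffProfile, abs_div, abs_of_pos (by positivity : 0 < 8 * Real.pi ^ 2 * t ^ 3),
    div_le_iff₀ (by positivity)]
  calc _ ≤ 2 * t ^ 2 := hnum
    _ ≤ 8 * Real.pi ^ 2 * t ^ 2 := by gcongr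
    _ = _ := by field_simp

lemma abs_diffProfile_le_inv_sq {t : ℝ} (ht : 1 ≤ t) : |diffProfile t| ≤ (t ^ 2)⁻¹ := by
  have hpi : 3 ≤ 8 * Real.pi ^ 2 := by nlinarith [Real.pi_gt_three]
  have hnum : |Real.cos t + t * Real.sin t - 1| ≤ 3 * t := by
    have h1 := Real.neg_one_le_cos t
    have h2 := Real.cos_le_one t
    have h3 := Real.neg_one_le_sin t
    have h4 := Real.sin_le_one t
    rw [abs_le]
    constructor <;> nlinarith
  have ht0 : 0 < t := by linarith
  rw [diffProfile, abs_div, abs_of_pos (by positivity : 0 < 8 * Real.pi ^ 2 * t ^ 3),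
    div_le_iff₀ (by positivity)]
  calc _ ≤ 3 * t := hnum
    _ ≤ 8 * Real.pi ^ 2 * t := by gcongr
    _ = _ := by field_simp

lemma measurable_diffProfile : Measurable diffProfile := by
  unfold diffProfile
  fun_prop

lemma integrableOn_diffProfile_rpow :
    IntegrableOn (fun t : ℝ => t ^ 4 * ‖diffProfile t‖ ^ (10 / 3 : ℝ)) (Set.Ioi 0) := by
  have hmeas : Measurable fun t : ℝ => t ^ 4 * ‖diffProfile t‖ ^ (10 / 3 : ℝ) := by
    have := measurable_diffProfile
    fun_prop
  rw [← Set.Ioc_union_Ioi_eq_Ioi zero_le_one]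
  refine IntegrableOn.union ?_ ?_
  · refine Measure.integrableOn_of_bounded (M := 1) measure_Ioc_lt_top.ne
      hmeas.aestronglyMeasurable ?_
    filter_upwards [ae_restrict_mem measurableSet_Ioc] with t ht
    rw [Real.norm_of_nonneg (by positivity)]
    have h : ‖diffProfile t‖ ^ (10 / 3 : ℝ) ≤ t⁻¹ ^ (4 : ℝ) :=
      (Real.rpow_le_rpow (norm_nonneg _) (abs_diffProfile_le_inv ht.1) (by norm_num)).trans
        (Real.rpow_le_rpow_of_exponent_le ((one_le_inv₀ ht.1).2 ht.2) (by norm_num))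
    have ht0 := ht.1
    calc _ ≤ t ^ 4 * t⁻¹ ^ (4 : ℝ) := by gcongr
      _ = 1 := by
        rw [show (4 : ℝ) = (4 : ℕ) by norm_num, Real.rpow_natCast]
        field_simp
  · refine (integrableOn_Ioi_rpow_of_lt (a := -(8 / 3 : ℝ)) (by norm_num) one_pos).mono'
      hmeas.aestronglyMeasurable ?_
    filter_upwards [ae_restrict_mem measurableSet_Ioi] with t ht
    have ht1 : 1 ≤ t := le_of_lt ht
    have ht0 : 0 < t := one_pos.trans ht
    rw [Real.norm_of_nonneg (by positivity)]
    calc _ ≤ t ^ 4 * ((t ^ 2)⁻¹) ^ (10 / 3 : ℝ) := by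
          gcongr
          exact abs_diffProfile_le_inv_sq ht1
      _ = t ^ (-(8 / 3 : ℝ)) := by
        rw [← Real.rpow_natCast, ← Real.rpow_natCast, ← Real.rpow_neg ht0.le,
          ← Real.rpow_mul ht0.le, ← Real.rpow_add ht0]
        norm_num

lemma memLp_diffProfile_norm :
    MemLp (fun x : E5 => diffProfile ‖x‖) (10 / 3 : ℝ≥0∞) volume := by
  have hmeas : AEStronglyMeasurable (fun x : E5 => diffProfile ‖x‖) volume :=
    (measurable_diffProfile.comp measurable_norm).aestronglyMeasurable
  rw [← integrable_norm_rpow_iff hmeas (by simp) (ENNReal.div_ne_top (by simp) (by simp))]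
  have h := (integrable_fun_norm_addHaar (volume : Measure E5)
    (f := fun t => ‖diffProfile t‖ ^ (10 / 3 : ℝ))).2
      (by simpa using integrableOn_diffProfile_rpow)
  simpa using h

instance : ENNReal.HolderConjugate (10 / 3) (10 / 7) where
  inv_add_inv_eq_inv := by
    rw [ENNReal.inv_div (by simp) (by simp), ENNReal.inv_div (by simp) (by simp),
      ENNReal.div_add_div_same, inv_one]
    norm_num
    exact ENNReal.div_self (by simp) (by simp)

instance : Fact ((10 / 3 : ℝ≥0∞) ≠ ∞) :=
  ⟨ENNReal.div_ne_top (by simp) (by simp)⟩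

/-- Proposition 2.3(ii), five-dimensional case: for `f ∈ L^{10/7}(ℝ⁵)` the convolution
`(Ψ - Λ) * f` converges absolutely a.e., and for every `r > 0` the operator
`f ↦ 1_{B_r}·((Ψ - Λ) * f)` is a well-defined, bounded and compact linear operator from
`L^{10/7}(ℝ⁵)` to `L^{10/3}(ℝ⁵)`. -/
theorem stmt8 :
    (∀ f : Lp ℝ (10/7 : ℝ≥0∞) (volume : Measure E5),
      ∀ᵐ x : E5, Integrable (fun y => (Psi5 (x - y) - Lambda5 (x - y)) * (f : E5 → ℝ) y)) ∧
    (∀ r : ℝ, 0 < r →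
      ∃ T : Lp ℝ (10/7 : ℝ≥0∞) (volume : Measure E5) →L[ℝ]
            Lp ℝ (10/3 : ℝ≥0∞) (volume : Measure E5),
        IsCompactOperator T ∧
        ∀ f, (T f : E5 → ℝ) =ᵐ[volume]
          (ball (0 : E5) r).indicator
            (fun x => ∫ y, (Psi5 (x - y) - Lambda5 (x - y)) * (f : E5 → ℝ) y)) := by
  simp only [Psi5_sub_Lambda5]
  exact ⟨fun f => ae_of_all _ (integrable_convolution_of_memLp memLp_diffProfile_norm f),
    fun r _ => exists_isCompactOperator_convolution memLp_diffProfile_norm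
      (fun x => by rw [norm_neg]) r⟩

end
end
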